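/- Let X be a unital C*-algebra with state space E. Every affine weak*-continuous real-valued function f on E is of the form f = Â for a (unique) self-adjoint element A ∈ X, where Â(ρ) = ρ(A). Hence the space of affine weak*-continuous real-valued functions on E coincides with {Â : A ∈ X, A = A*}. -/

import Mathlib

open scoped ComplexOrder

/-- The state space of a unital C*-algebra `X`. -/
def stateSpace (X : Type*) [NormedRing X] [StarRing X] [NormedAlgebra ℂ X] :
    Set (WeakDual ℂ X) :=
  {ρ | (∀ a : X, 0 ≤ ρ (star a * a)) ∧ ρ 1 = 1}

open scoped ComplexStarModule

/-- A continuous affine function on a compact convex set is uniformly approximated by restrictions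
of continuous affine functions on the whole space. -/
lemma exists_strongDual_add_const_approx {V : Type*} [AddCommGroup V] [Module ℝ V]
    [TopologicalSpace V] [IsTopologicalAddGroup V] [ContinuousSMul ℝ V] [LocallyConvexSpace ℝ V]
    [T2Space V] {K : Set V} (hK : IsCompact K) (hconv : Convex ℝ K) {f : V → ℝ}
    (hf : ContinuousOn f K)
    (haff : ∀ x ∈ K, ∀ y ∈ K, ∀ t : ℝ, t ∈ Set.Ioo (0 : ℝ) 1 →
      f ((1 - t) • x + t • y) = (1 - t) * f x + t * f y) {ε : ℝ} (hε : 0 < ε) :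
    ∃ (φ : StrongDual ℝ V) (c : ℝ), ∀ x ∈ K, |f x - (φ x + c)| ≤ ε := by
  obtain rfl | ⟨x₀, hx₀⟩ := K.eq_empty_or_nonempty
  · exact ⟨0, 0, by simp⟩
  have hgraph_compact (δ : ℝ) : IsCompact ((fun x ↦ (x, f x + δ)) '' K) :=
    hK.image_of_continuousOn (by fun_prop)
  have hgraph_convex (δ : ℝ) : Convex ℝ ((fun x ↦ (x, f x + δ)) '' K) := by
    rw [convex_iff_forall_pos]
    rintro _ ⟨x, hx, rfl⟩ _ ⟨y, hy, rfl⟩ a b ha hb hab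
    obtain rfl : a = 1 - b := by linarith
    refine ⟨(1 - b) • x + b • y, hconv hx hy ha.le hb.le hab, ?_⟩
    ext
    · simp
    · simp only [haff x hx y hy b ⟨hb, by linarith⟩, Prod.snd_add, Prod.smul_snd, smul_eq_mul]
      ring
  have hdisj : Disjoint ((fun x ↦ (x, f x + 0)) '' K) ((fun x ↦ (x, f x + ε)) '' K) := by
    rw [Set.disjoint_left]
    rintro _ ⟨x, -, rfl⟩ ⟨y, -, hxy⟩
    obtain ⟨rfl, h⟩ := Prod.ext_iff.1 hxy
    simp only at h
    linarith
  obtain ⟨L, u, v, hu, huv, hv⟩ := geometric_hahn_banach_compact_closed (hgraph_convex 0)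
    (hgraph_compact 0) (hgraph_convex ε) (hgraph_compact ε).isClosed hdisj
  have hL (x : V) (s : ℝ) : L (x, s) = L (x, 0) + s * L (0, 1) := by
    rw [← smul_eq_mul, ← map_smul, ← map_add]
    simp
  set c := L (0, 1)
  have hlow (x) (hx : x ∈ K) : L (x, 0) + f x * c < u := by
    simpa [hL x (f x)] using hu _ ⟨x, hx, rfl⟩
  have hup (x) (hx : x ∈ K) : v < L (x, 0) + (f x + ε) * c := by
    simpa [hL x (f x + ε)] using hv _ ⟨x, hx, rfl⟩
  have hc : 0 < c := by
    have := hlow x₀ hx₀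
    have := hup x₀ hx₀
    by_contra! h
    nlinarith
  refine ⟨-c⁻¹ • L.comp (ContinuousLinearMap.inl ℝ V ℝ), u / c, fun x hx ↦ ?_⟩
  have h1 := hlow x hx
  have h2 := hup x hx
  have h3 : f x - ((-c⁻¹ • L.comp (ContinuousLinearMap.inl ℝ V ℝ)) x + u / c)
      = (L (x, 0) + f x * c - u) / c := by
    simp
    field_simp
    ring
  rw [h3, abs_div, abs_of_pos hc, div_le_iff₀ hc, abs_le]
  constructor <;> nlinarith

instance WeakDual.isScalarTower_real_complex {X : Type*} [NormedAddCommGroup X] [NormedSpace ℂ X] :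
    IsScalarTower ℝ ℂ (WeakDual ℂ X) :=
  ⟨fun r z ρ ↦ DFunLike.ext _ _ fun a ↦ smul_assoc r z (ρ a)⟩

/-- Weak*-continuous real-linear functionals on the dual are real parts of evaluations. -/
lemma WeakDual.exists_eq_re_apply {X : Type*} [NormedAddCommGroup X] [NormedSpace ℂ X]
    (φ : StrongDual ℝ (WeakDual ℂ X)) : ∃ a : X, ∀ ρ : WeakDual ℂ X, φ ρ = (ρ a).re := by
  obtain ⟨a, ha⟩ := LinearMap.dualEmbedding_surjective (B := topDualPairing ℂ X)
    (φ.extendRCLike (𝕜 := ℂ))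
  refine ⟨a, fun ρ ↦ ?_⟩
  rw [← StrongDual.re_extendRCLike_apply (𝕜 := ℂ) φ ρ]
  exact congrArg Complex.re (DFunLike.congr_fun ha ρ).symm

section CStarAlgebra

variable {X : Type*} [CStarAlgebra X]

lemma convex_stateSpace : Convex ℝ (stateSpace X) := by
  intro ρ hρ υ hυ s t hs ht hst
  have hs' : (0 : ℂ) ≤ s := by exact_mod_cast hs
  have ht' : (0 : ℂ) ≤ t := by exact_mod_cast ht
  have happ (a : X) : (s • ρ + t • υ) a = s * ρ a + t * υ a := by
    change s • ρ a + t • υ a = _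
    simp
  refine ⟨fun a ↦ ?_, ?_⟩
  · rw [happ]
    exact add_nonneg (mul_nonneg hs' (hρ.1 a)) (mul_nonneg ht' (hυ.1 a))
  · rw [happ, hρ.2, hυ.2]
    exact_mod_cast by simpa using hst

lemma isClosed_stateSpace : IsClosed (stateSpace X) := by
  have h : stateSpace X = (⋂ a : X, {ρ | 0 ≤ ρ (star a * a)}) ∩ {ρ | ρ 1 = 1} := by
    ext ρ
    simp [stateSpace]
  rw [h]
  exact (isClosed_iInter fun a ↦ isClosed_le continuous_const (WeakDual.eval_continuous _)).inter
    (isClosed_eq (WeakDual.eval_continuous _) continuous_const)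

lemma apply_algebraMap_of_mem_stateSpace {ρ : WeakDual ℂ X} (hρ : ρ ∈ stateSpace X) (r : ℝ) :
    ρ (algebraMap ℝ X r) = r := by
  rw [IsScalarTower.algebraMap_apply ℝ ℂ X, Algebra.algebraMap_eq_smul_one, map_smul, hρ.2]
  simp

/-- The complex-linear functional agreeing on self-adjoint elements with a real-linear one. -/
lemma exists_strongDual_eq_on_selfAdjoint (φ : StrongDual ℝ X) :
    ∃ ψ : StrongDual ℂ X, ∀ a : X, IsSelfAdjoint a → ψ a = φ a := by
  let R : X →L[ℝ] X := (2⁻¹ : ℝ) • (ContinuousLinearMap.id ℝ X + (starL' ℝ : X ≃L[ℝ] X))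
  have hR (a : X) : R a = (2⁻¹ : ℝ) • (a + star a) := rfl
  refine ⟨StrongDual.extendRCLike (φ.comp R), fun a ha ↦ ?_⟩
  have h1 : R a = a := by
    rw [hR, ha.star_eq, ← two_smul ℝ a, smul_smul]
    norm_num
  have h2 : R (Complex.I • a) = 0 := by
    rw [hR, star_smul, ha.star_eq]
    simp
  rw [StrongDual.extendRCLike_apply]
  simp [h1, h2]

variable [PartialOrder X] [StarOrderedRing X]

lemma apply_nonneg_of_mem_stateSpace {ρ : WeakDual ℂ X} (hρ : ρ ∈ stateSpace X) {a : X}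
    (ha : 0 ≤ a) : 0 ≤ ρ a := by
  obtain ⟨b, rfl⟩ := CStarAlgebra.nonneg_iff_eq_star_mul_self.1 ha
  exact hρ.1 b

lemma im_apply_eq_zero_of_mem_stateSpace {ρ : WeakDual ℂ X} (hρ : ρ ∈ stateSpace X) {a : X}
    (ha : IsSelfAdjoint a) : (ρ a).im = 0 := by
  have h := apply_nonneg_of_mem_stateSpace hρ (sub_nonneg.2 ha.le_algebraMap_norm_self)
  rw [map_sub, apply_algebraMap_of_mem_stateSpace hρ, Complex.nonneg_iff] at h
  simpa using h.2.symm

lemma norm_apply_le_of_mem_stateSpace {ρ : WeakDual ℂ X} (hρ : ρ ∈ stateSpace X) {a : X}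
    (ha : IsSelfAdjoint a) : ‖ρ a‖ ≤ ‖a‖ := by
  have h := apply_nonneg_of_mem_stateSpace hρ (sub_nonneg.2 ha.le_algebraMap_norm_self)
  have h' := apply_nonneg_of_mem_stateSpace hρ (sub_nonneg.2 ha.neg_algebraMap_norm_le_self)
  rw [map_sub, apply_algebraMap_of_mem_stateSpace hρ, Complex.nonneg_iff] at h
  rw [map_sub, map_neg, apply_algebraMap_of_mem_stateSpace hρ, Complex.nonneg_iff] at h'
  simp only [Complex.sub_re, Complex.neg_re, Complex.ofReal_re] at h h'
  rw [← Complex.abs_re_eq_norm.2 (im_apply_eq_zero_of_mem_stateSpace hρ ha), abs_le]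
  constructor <;> linarith [h.1, h'.1]

lemma re_apply_realPart_of_mem_stateSpace {ρ : WeakDual ℂ X} (hρ : ρ ∈ stateSpace X) (a : X) :
    (ρ (ℜ a : X)).re = (ρ a).re := by
  conv_rhs => rw [← realPart_add_I_smul_imaginaryPart a, map_add, map_smul]
  simp [im_apply_eq_zero_of_mem_stateSpace hρ (ℑ a).2]

lemma isCompact_stateSpace : IsCompact (stateSpace X) := by
  refine (WeakDual.isCompact_closedBall (𝕜 := ℂ) (E := X) 0 2).of_isClosed_subset
    isClosed_stateSpace fun ρ hρ ↦ ?_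
  simp only [Set.mem_preimage, mem_closedBall_zero_iff]
  refine ContinuousLinearMap.opNorm_le_bound _ zero_le_two fun a ↦ ?_
  change ‖ρ a‖ ≤ _
  have h1 := norm_apply_le_of_mem_stateSpace hρ (ℜ a).2
  have h2 := norm_apply_le_of_mem_stateSpace hρ (ℑ a).2
  have h3 : ‖(ℜ a : X)‖ ≤ ‖a‖ := realPart.norm_le a
  have h4 : ‖(ℑ a : X)‖ ≤ ‖a‖ := imaginaryPart.norm_le a
  calc ‖ρ a‖ = ‖ρ (ℜ a : X) + Complex.I • ρ (ℑ a : X)‖ := by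
        rw [← map_smul, ← map_add, realPart_add_I_smul_imaginaryPart]
    _ ≤ ‖ρ (ℜ a : X)‖ + ‖Complex.I • ρ (ℑ a : X)‖ := norm_add_le _ _
    _ = ‖ρ (ℜ a : X)‖ + ‖ρ (ℑ a : X)‖ := by simp
    _ ≤ 2 * ‖a‖ := by linarith

/-- States detect positivity of self-adjoint elements. -/
lemma nonneg_of_forall_mem_stateSpace {a : X} (ha : IsSelfAdjoint a)
    (h : ∀ ρ ∈ stateSpace X, 0 ≤ (ρ a).re) : 0 ≤ a := by
  by_contra hneg
  have hconv : Convex ℝ {b : X | 0 ≤ b} := convex_Ici 0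
  obtain ⟨φ, u, hu, hφ⟩ :=
    geometric_hahn_banach_point_closed hconv CStarAlgebra.isClosed_nonneg hneg
  have hu0 : u < 0 := by simpa using hφ 0 le_rfl
  have hpos (b : X) (hb : 0 ≤ b) : 0 ≤ φ b := by
    by_contra! hlt
    have := hφ ((u / φ b) • b) (smul_nonneg (div_nonneg_of_nonpos hu0.le hlt.le) hb)
    rw [map_smul, smul_eq_mul, div_mul_cancel₀ _ hlt.ne] at this
    exact lt_irrefl _ this
  have hone : 0 < φ 1 := by
    have h1 := hpos _ (sub_nonneg.2 ha.neg_algebraMap_norm_le_self)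
    rw [map_sub, map_neg, Algebra.algebraMap_eq_smul_one, map_smul, smul_eq_mul] at h1
    have h2 := hpos 1 zero_le_one
    by_contra! h3
    have h4 : φ 1 = 0 := le_antisymm h3 h2
    rw [h4] at h1
    linarith
  obtain ⟨ψ, hψ⟩ := exists_strongDual_eq_on_selfAdjoint φ
  have happ (b : X) (hb : IsSelfAdjoint b) :
      StrongDual.toWeakDual (((φ 1)⁻¹ : ℂ) • ψ) b = ((φ b / φ 1 : ℝ) : ℂ) := by
    change ((φ 1)⁻¹ : ℂ) • ψ b = _
    rw [hψ b hb, smul_eq_mul]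
    push_cast
    ring
  have hmem : StrongDual.toWeakDual (((φ 1)⁻¹ : ℂ) • ψ) ∈ stateSpace X := by
    refine ⟨fun b ↦ ?_, ?_⟩
    · rw [happ _ (IsSelfAdjoint.star_mul_self b)]
      exact_mod_cast div_nonneg (hpos _ (star_mul_self_nonneg b)) hone.le
    · rw [happ _ (IsSelfAdjoint.one X), div_self hone.ne', Complex.ofReal_one]
  have hlast := h _ hmem
  rw [happ a ha, Complex.ofReal_re] at hlast
  exact absurd hlast (not_le.2 (div_neg_of_neg_of_pos (hu.trans hu0) hone))

/-- The norm of a self-adjoint element is controlled by its values on states. -/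
lemma norm_le_of_forall_mem_stateSpace {a : X} (ha : IsSelfAdjoint a) {r : ℝ} (hr : 0 ≤ r)
    (h : ∀ ρ ∈ stateSpace X, |(ρ a).re| ≤ r) : ‖a‖ ≤ r := by
  obtain _ | _ := subsingleton_or_nontrivial X
  · simpa [Subsingleton.elim a 0] using hr
  have hrsa : IsSelfAdjoint (algebraMap ℝ X r) := .algebraMap X (.all r)
  have hle : a ≤ algebraMap ℝ X r := by
    refine sub_nonneg.1 (nonneg_of_forall_mem_stateSpace (hrsa.sub ha) fun ρ hρ ↦ ?_)
    rw [map_sub, apply_algebraMap_of_mem_stateSpace hρ]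
    simpa using (abs_le.1 (h ρ hρ)).2
  have hge : algebraMap ℝ X (-r) ≤ a := by
    rw [map_neg]
    refine sub_nonneg.1 (nonneg_of_forall_mem_stateSpace (ha.sub hrsa.neg) fun ρ hρ ↦ ?_)
    rw [map_sub, map_neg, apply_algebraMap_of_mem_stateSpace hρ]
    have := (abs_le.1 (h ρ hρ)).1
    simp only [Complex.sub_re, Complex.neg_re, Complex.ofReal_re]
    linarith
  obtain hs | hs := CStarAlgebra.norm_or_neg_norm_mem_spectrum ha
  · exact (le_algebraMap_iff_spectrum_le ha).1 hle _ hs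
  · exact neg_le_neg_iff.1 ((algebraMap_le_iff_le_spectrum ha).1 hge _ hs)

/-- Affine weak*-continuous functions on the state space are uniformly approximated by self-adjoint
elements. -/
lemma exists_isSelfAdjoint_approx {f : WeakDual ℂ X → ℝ} (hf_cont : ContinuousOn f (stateSpace X))
    (hf_affine : ∀ ρ ∈ stateSpace X, ∀ υ ∈ stateSpace X, ∀ t : ℝ, t ∈ Set.Ioo (0 : ℝ) 1 →
      f (((1 - t : ℝ) : ℂ) • ρ + ((t : ℝ) : ℂ) • υ) = (1 - t) * f ρ + t * f υ)
    {ε : ℝ} (hε : 0 < ε) :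
    ∃ a : X, IsSelfAdjoint a ∧ ∀ ρ ∈ stateSpace X, |f ρ - (ρ a).re| ≤ ε := by
  -- These are passed explicitly because instance search does not unify the `SMul ℝ` paths.
  obtain ⟨φ, c, hφ⟩ := @exists_strongDual_add_const_approx (WeakDual ℂ X) _ _ _ _
    (IsScalarTower.continuousSMul ℂ) (WeakDual.withSeminorms ℂ X).toLocallyConvexSpace _ _
    isCompact_stateSpace convex_stateSpace _ hf_cont
    (fun ρ hρ υ hυ t ht ↦ hf_affine ρ hρ υ hυ t ht) _ hε
  obtain ⟨a, ha⟩ := WeakDual.exists_eq_re_apply φ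
  refine ⟨ℜ a + algebraMap ℝ X c, (ℜ a).2.add (.algebraMap X (.all c)), fun ρ hρ ↦ ?_⟩
  rw [map_add, Complex.add_re, re_apply_realPart_of_mem_stateSpace hρ, ← ha,
    apply_algebraMap_of_mem_stateSpace hρ, Complex.ofReal_re]
  exact hφ ρ hρ

lemma exists_isSelfAdjoint_eq {f : WeakDual ℂ X → ℝ} (hf_cont : ContinuousOn f (stateSpace X))
    (hf_affine : ∀ ρ ∈ stateSpace X, ∀ υ ∈ stateSpace X, ∀ t : ℝ, t ∈ Set.Ioo (0 : ℝ) 1 →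
      f (((1 - t : ℝ) : ℂ) • ρ + ((t : ℝ) : ℂ) • υ) = (1 - t) * f ρ + t * f υ) :
    ∃ a : X, IsSelfAdjoint a ∧ ∀ ρ ∈ stateSpace X, f ρ = (ρ a).re := by
  choose a ha hfa using fun n : ℕ ↦
    exists_isSelfAdjoint_approx hf_cont hf_affine (Nat.one_div_pos_of_nat (α := ℝ) (n := n))
  have hdist (n m N : ℕ) (hn : N ≤ n) (hm : N ≤ m) :
      dist (a n) (a m) ≤ 2 * (1 / ((N : ℝ) + 1)) := by
    rw [dist_eq_norm]
    refine norm_le_of_forall_mem_stateSpace ((ha n).sub (ha m)) (by positivity) fun ρ hρ ↦ ?_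
    have h1 := abs_le.1 ((hfa n ρ hρ).trans (Nat.one_div_le_one_div hn))
    have h2 := abs_le.1 ((hfa m ρ hρ).trans (Nat.one_div_le_one_div hm))
    rw [map_sub, Complex.sub_re, abs_le]
    constructor <;> linarith [h1.1, h1.2, h2.1, h2.2]
  have hcauchy : CauchySeq a := cauchySeq_of_le_tendsto_0 _ hdist (by
    simpa using (tendsto_one_div_add_atTop_nhds_zero_nat (𝕜 := ℝ)).const_mul 2)
  obtain ⟨b, hb⟩ := cauchySeq_tendsto_of_complete hcauchy
  refine ⟨b, (isClosed_eq continuous_star continuous_id).mem_of_tendsto hb (.of_forall ha),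
    fun ρ hρ ↦ ?_⟩
  have hlim : Filter.Tendsto (fun n ↦ f ρ - (ρ (a n)).re) Filter.atTop
      (nhds (f ρ - (ρ b).re)) :=
    ((Complex.continuous_re.comp (map_continuous ρ)).tendsto b |>.comp hb).const_sub (f ρ)
  exact sub_eq_zero.1 (tendsto_nhds_unique hlim
    (squeeze_zero_norm (hfa · ρ hρ) tendsto_one_div_add_atTop_nhds_zero_nat))

end CStarAlgebra

/-- Every affine weak*-continuous real-valued function `f` on the state
space `E` of a unital C*-algebra `X` is of the form `ρ ↦ ρ A` (i.e. `f = Â = Re ∘ Â`) for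
a unique self-adjoint element `A ∈ X`. -/
theorem affine_continuous_eq_gelfand (X : Type*) [NormedRing X] [StarRing X] [CStarRing X]
    [NormedAlgebra ℂ X] [StarModule ℂ X] [CompleteSpace X]
    (f : WeakDual ℂ X → ℝ)
    (hf_cont : ContinuousOn f (stateSpace X))
    (hf_affine : ∀ ρ ∈ stateSpace X, ∀ υ ∈ stateSpace X, ∀ t : ℝ, t ∈ Set.Ioo (0 : ℝ) 1 →
      f (((1 - t : ℝ) : ℂ) • ρ + ((t : ℝ) : ℂ) • υ) = (1 - t) * f ρ + t * f υ) :
    ∃! A : X, IsSelfAdjoint A ∧ ∀ ρ ∈ stateSpace X, f ρ = (ρ A).re := by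
  let : CStarAlgebra X := {}
  let : PartialOrder X := CStarAlgebra.spectralOrder X
  have : StarOrderedRing X := CStarAlgebra.spectralOrderedRing X
  obtain ⟨a, ha, hfa⟩ := exists_isSelfAdjoint_eq hf_cont hf_affine
  refine ⟨a, ⟨ha, hfa⟩, fun b ⟨hb, hfb⟩ ↦ ?_⟩
  rw [← sub_eq_zero, ← norm_le_zero_iff]
  refine norm_le_of_forall_mem_stateSpace (hb.sub ha) le_rfl fun ρ hρ ↦ ?_
  rw [map_sub, Complex.sub_re, ← hfa ρ hρ, ← hfb ρ hρ]
  simp
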